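/- Zeros for Angelesco systems: let Δ₁, …, Δ_r be pairwise disjoint compact intervals in ℝ, and for each j let μ_j be a positive Borel measure whose support is an infinite subset of Δ_j, with all moments finite. Let (n₁,…,n_r) be a multi-index with |n| = n₁ + ⋯ + n_r, and let P be a nonzero polynomial with real coefficients of degree ≤ |n| satisfying the multiple orthogonality conditions ∫ x^k P(x) dμ_j(x) = 0 for every j and every k = 0, 1, …, n_j − 1. Then for each j, P has at least n_j distinct roots of odd multiplicity in the interior of Δ_j; consequently deg P = |n| and P has exactly n_j simple zeros in the interior of each Δ_j. -/

import Mathlib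

open MeasureTheory Polynomial

/-- The support of a Borel measure on `ℝ`: the set of points all of whose neighborhoods
have positive measure. -/
def measureSupport (μ : Measure ℝ) : Set ℝ :=
  {x | ∀ ε > 0, 0 < μ (Metric.ball x ε)}

theorem poly_no_sign_change (a b : ℝ) (n : ℕ) : ∀ R : Polynomial ℝ, R ≠ 0 → R.natDegree ≤ n →
    (∀ x ∈ Set.Ioo a b, Even (R.rootMultiplicity x)) →
    (∀ x ∈ Set.Ioo a b, 0 ≤ R.eval x) ∨ (∀ x ∈ Set.Ioo a b, R.eval x ≤ 0) := by
  induction n using Nat.strong_induction_on with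
  | _ n ih =>
    intro R hR hn heven
    by_cases hroot : ∃ c ∈ Set.Ioo a b, R.eval c = 0
    · obtain ⟨c, hc, hRc⟩ := hroot
      obtain ⟨R', hR', hnd⟩ := Polynomial.exists_eq_pow_rootMultiplicity_mul_and_not_dvd R hR c
      have hm : 0 < R.rootMultiplicity c := (Polynomial.rootMultiplicity_pos hR).2 hRc
      have hme := heven c hc
      generalize R.rootMultiplicity c = m at *
      have hR'0 : R' ≠ 0 := by
        rintro rfl
        simp at hnd
      have hdeg : R.natDegree = m + R'.natDegree := by
        rw [hR', Polynomial.natDegree_mul (pow_ne_zero _ (Polynomial.X_sub_C_ne_zero c)) hR'0]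
        simp
      have heven' : ∀ x ∈ Set.Ioo a b, Even (R'.rootMultiplicity x) := by
        intro x hx
        have h1 := heven x hx
        rw [hR', Polynomial.rootMultiplicity_mul (by rw [← hR']; exact hR)] at h1
        by_cases hxc : x = c
        · subst hxc
          rw [Polynomial.rootMultiplicity_eq_zero]
          · simp
          · rwa [← Polynomial.dvd_iff_isRoot]
        · have : ((X - C c) ^ m : ℝ[X]).rootMultiplicity x = 0 := by
            apply Polynomial.rootMultiplicity_eq_zero
            simp [Polynomial.IsRoot, sub_eq_zero, hxc]
          rwa [this, zero_add] at h1
      have key : ∀ x, R.eval x = (x - c) ^ m * R'.eval x := by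
        intro x
        rw [hR']; simp
      rcases ih R'.natDegree (by omega) R' hR'0 le_rfl heven' with h | h
      · left
        intro x hx
        rw [key]
        exact mul_nonneg (hme.pow_nonneg _) (h x hx)
      · right
        intro x hx
        rw [key]
        exact mul_nonpos_of_nonneg_of_nonpos (hme.pow_nonneg _) (h x hx)
    · push Not at hroot
      by_contra hcon
      push Not at hcon
      obtain ⟨⟨x, hx, hx0⟩, ⟨y, hy, hy0⟩⟩ := hcon
      have hpre : IsPreconnected (Set.Ioo a b) := isPreconnected_Ioo
      obtain ⟨z, hz, hz0⟩ := hpre.intermediate_value hx hy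
        (f := fun t => R.eval t) R.continuous.continuousOn ⟨hx0.le, hy0.le⟩
      exact hroot z hz hz0

theorem poly_integrable (μ : Measure ℝ) (hmom : ∀ k : ℕ, Integrable (fun x => |x| ^ k) μ)
    (R : Polynomial ℝ) : Integrable (fun x => R.eval x) μ := by
  have h : ∀ k : ℕ, Integrable (fun x : ℝ => x ^ k) μ := by
    intro k
    refine (hmom k).mono' (by fun_prop) ?_
    filter_upwards with x
    simp
  simp only [Polynomial.eval_eq_sum_range]
  exact integrable_finsetSum _ fun i _ => (h i).const_mul _

theorem ae_mem_of_support (μ : Measure ℝ) (a b : ℝ)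
    (hsupp : measureSupport μ ⊆ Set.Icc a b) : ∀ᵐ x ∂μ, x ∈ Set.Icc a b := by
  rw [ae_iff]
  refine measure_null_of_locally_null _ fun x hx => ?_
  have hx' : x ∉ measureSupport μ := fun h => hx (hsupp h)
  simp only [measureSupport, Set.mem_ofPred_eq, not_forall, not_lt, nonpos_iff_eq_zero] at hx'
  obtain ⟨ε, hε, h⟩ := hx'
  exact ⟨Metric.ball x ε, mem_nhdsWithin_of_mem_nhds (Metric.ball_mem_nhds x hε), h⟩

theorem poly_ae_zero_false (μ : Measure ℝ) (hinf : (measureSupport μ).Infinite)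
    (R : Polynomial ℝ) (hR : R ≠ 0) (h : ∀ᵐ x ∂μ, R.eval x = 0) : False := by
  apply hinf
  refine Set.Finite.subset R.roots.toFinset.finite_toSet fun x hx => ?_
  simp only [Finset.mem_coe, Multiset.mem_toFinset, Polynomial.mem_roots hR, Polynomial.IsRoot]
  by_contra hne
  have hnhds : {y : ℝ | R.eval y ≠ 0} ∈ nhds x :=
    (isOpen_ne_fun R.continuous continuous_const).mem_nhds hne
  obtain ⟨ε, hε, hsub⟩ := Metric.mem_nhds_iff.1 hnhds
  have := hx ε hε
  exact this.ne' (measure_mono_null hsub (ae_iff.1 h))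

theorem odd_roots_card (a b : ℝ) (μ : Measure ℝ)
    (hsupp : measureSupport μ ⊆ Set.Icc a b)
    (hinf : (measureSupport μ).Infinite)
    (hmom : ∀ k : ℕ, Integrable (fun x => |x| ^ k) μ)
    (n : ℕ) (P : Polynomial ℝ) (hP : P ≠ 0)
    (horth : ∀ k : ℕ, k < n → ∫ x, x ^ k * P.eval x ∂μ = 0) :
    ∃ S : Finset ℝ, n ≤ S.card ∧
        ∀ x ∈ S, x ∈ Set.Ioo a b ∧ Odd (P.rootMultiplicity x) := by
  classical
  let S := P.roots.toFinset.filter fun x => x ∈ Set.Ioo a b ∧ Odd (P.rootMultiplicity x)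
  refine ⟨S, ?_, fun x hx => (Finset.mem_filter.1 hx).2⟩
  by_contra hlt
  push Not at hlt
  have hab : a < b := by
    by_contra h
    exact hinf ((Set.subsingleton_Icc_of_ge (not_lt.1 h)).finite.subset hsupp)
  let Q : Polynomial ℝ := ∏ s ∈ S, (X - C s)
  have hQ : Q ≠ 0 := Finset.prod_ne_zero_iff.2 fun s _ => Polynomial.X_sub_C_ne_zero s
  have hQdeg : Q.natDegree = S.card := by
    exact Polynomial.natDegree_finsetProd_X_sub_C_eq_card S (fun x => x)
  have hQroots : Q.roots = S.val := Polynomial.roots_prod_X_sub_C S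
  have hQP : Q * P ≠ 0 := mul_ne_zero hQ hP
  have heven : ∀ x ∈ Set.Ioo a b, Even ((Q * P).rootMultiplicity x) := by
    intro x hx
    rw [Polynomial.rootMultiplicity_mul hQP, ← Polynomial.count_roots Q, hQroots]
    by_cases hxS : x ∈ S
    · rw [Multiset.count_eq_one_of_mem S.nodup hxS]
      exact odd_one.add_odd (Finset.mem_filter.1 hxS).2.2
    · rw [Multiset.count_eq_zero_of_notMem hxS, zero_add]
      by_contra hodd
      rw [Nat.not_even_iff_odd] at hodd
      apply hxS
      refine Finset.mem_filter.2 ⟨?_, hx, hodd⟩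
      rw [Multiset.mem_toFinset, ← Multiset.count_pos, Polynomial.count_roots]
      exact hodd.pos
  have hint : ∫ x, (Q * P).eval x ∂μ = 0 := by
    have h1 : ∀ x, (Q * P).eval x =
        ∑ k ∈ Finset.range (Q.natDegree + 1), Q.coeff k * (x ^ k * P.eval x) := by
      intro x
      rw [Polynomial.eval_mul, Polynomial.eval_eq_sum_range, Finset.sum_mul]
      exact Finset.sum_congr rfl fun k _ => by ring
    simp only [h1]
    rw [integral_finsetSum]
    · refine Finset.sum_eq_zero fun k hk => ?_
      rw [integral_const_mul, horth k, mul_zero]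
      have := Finset.mem_range.1 hk
      omega
    · intro k _
      refine Integrable.const_mul ?_ _
      have h2 : (fun x : ℝ => x ^ k * P.eval x) = fun x => (X ^ k * P).eval x := by
        funext x
        rw [Polynomial.eval_mul, Polynomial.eval_pow, Polynomial.eval_X]
      rw [h2]
      exact poly_integrable μ hmom (X ^ k * P)
  have hI := poly_integrable μ hmom (Q * P)
  have hae := ae_mem_of_support μ a b hsupp
  refine poly_ae_zero_false μ hinf (Q * P) hQP ?_
  rcases poly_no_sign_change a b _ (Q * P) hQP le_rfl heven with h | h
  · have hc : Set.Icc a b ⊆ {x | 0 ≤ (Q * P).eval x} := by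
      rw [← closure_Ioo hab.ne]
      exact closure_minimal h (isClosed_le continuous_const (Q * P).continuous)
    exact (integral_eq_zero_iff_of_nonneg_ae (hae.mono fun x hx => hc hx) hI).1 hint
  · have hc : Set.Icc a b ⊆ {x | (Q * P).eval x ≤ 0} := by
      rw [← closure_Ioo hab.ne]
      exact closure_minimal h (isClosed_le (Q * P).continuous continuous_const)
    have h2 := (integral_eq_zero_iff_of_nonneg_ae (μ := μ) (f := fun x => -(Q * P).eval x)
      (hae.mono fun x hx => by simpa using hc hx) hI.neg).1
      (by rw [integral_neg, hint, neg_zero])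
    exact h2.mono fun x hx => by simpa using hx

/-- **Zeros for Angelesco systems.** Let `Δⱼ = [aⱼ, bⱼ]` be pairwise disjoint compact intervals,
`μⱼ` positive Borel measures with infinite support in `Δⱼ` and all moments finite, and let `P`
be a nonzero real polynomial of degree ≤ `|n| = ∑ nⱼ` satisfying the multiple orthogonality
conditions `∫ x^k P dμⱼ = 0` for `k < nⱼ` and all `j`. Then for each `j`, `P` has at least `nⱼ`
distinct roots of odd multiplicity in the interior of `Δⱼ`; consequently `deg P = |n|` and `P`
has exactly `nⱼ` simple zeros in the interior of each `Δⱼ`. -/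
theorem angelesco_zeros (r : ℕ) (a b : Fin r → ℝ)
    (hdisj : ∀ i j, i ≠ j → Disjoint (Set.Icc (a i) (b i)) (Set.Icc (a j) (b j)))
    (μ : Fin r → Measure ℝ)
    (hsupp : ∀ j, measureSupport (μ j) ⊆ Set.Icc (a j) (b j))
    (hinf : ∀ j, (measureSupport (μ j)).Infinite)
    (hmom : ∀ j, ∀ k : ℕ, Integrable (fun x => |x| ^ k) (μ j))
    (nn : Fin r → ℕ) (P : Polynomial ℝ) (hP : P ≠ 0)
    (hdeg : P.degree ≤ (∑ j, nn j : ℕ))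
    (horth : ∀ j, ∀ k : ℕ, k < nn j → ∫ x, x ^ k * P.eval x ∂(μ j) = 0) :
    (∀ j, ∃ S : Finset ℝ, nn j ≤ S.card ∧
        ∀ x ∈ S, x ∈ Set.Ioo (a j) (b j) ∧ Odd (P.rootMultiplicity x)) ∧
      P.natDegree = ∑ j, nn j ∧
      ∀ j, ∃ S : Finset ℝ, S.card = nn j ∧
        (∀ x ∈ S, x ∈ Set.Ioo (a j) (b j) ∧ P.rootMultiplicity x = 1) ∧
        ∀ x ∈ Set.Ioo (a j) (b j), P.eval x = 0 → x ∈ S := by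
  classical
  have hmain := fun j => odd_roots_card (a j) (b j) (μ j) (hsupp j) (hinf j) (hmom j) (nn j) P hP
    (horth j)
  refine ⟨hmain, ?_⟩
  choose S hcard hS using hmain
  have hSdisj : ∀ i j, ∀ x ∈ S i, x ∈ Set.Ioo (a j) (b j) → i = j := by
    intro i j x hx hxj
    by_contra hij
    exact Set.disjoint_left.1 (hdisj i j hij) (Set.Ioo_subset_Icc_self (hS i x hx).1)
      (Set.Ioo_subset_Icc_self hxj)
  let T := Finset.univ.biUnion S
  have hTcard : T.card = ∑ j, (S j).card := by
    apply Finset.card_biUnion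
    intro i _ j _ hij
    refine Finset.disjoint_left.2 ?_
    intro x hx hxj
    exact hij (hSdisj i j x hx (hS j x hxj).1)
  have hTle : T.val ≤ P.roots := by
    rw [Multiset.le_iff_subset T.nodup]
    intro x hx
    obtain ⟨j, -, hj⟩ := Finset.mem_biUnion.1 (Finset.mem_def.2 hx)
    rw [← Multiset.count_pos, Polynomial.count_roots]
    exact (hS j x hj).2.pos
  have hsum : ∑ j, nn j ≤ ∑ j, (S j).card := Finset.sum_le_sum fun j _ => hcard j
  have hle : P.natDegree ≤ ∑ j, nn j := Polynomial.natDegree_le_of_degree_le hdeg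
  have hroots := Polynomial.card_roots' P
  have hTr : T.card ≤ P.roots.card := Multiset.card_le_card hTle
  have heq : T.val = P.roots := Multiset.eq_of_le_of_card_le hTle (by
    change P.roots.card ≤ T.card
    omega)
  have hcards : ∀ j, nn j = (S j).card := by
    have := (Finset.sum_eq_sum_iff_of_le (fun j (_ : j ∈ Finset.univ) => hcard j)).1 (by omega)
    exact fun j => this j (Finset.mem_univ j)
  refine ⟨by omega, fun j => ⟨S j, (hcards j).symm, fun x hx => ⟨(hS j x hx).1, ?_⟩, ?_⟩⟩
  · rw [← Polynomial.count_roots, ← heq]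
    exact Multiset.count_eq_one_of_mem T.nodup
      (Finset.mem_biUnion.2 ⟨j, Finset.mem_univ j, hx⟩)
  · intro x hx h0
    have hxr : x ∈ P.roots := (Polynomial.mem_roots hP).2 h0
    rw [← heq] at hxr
    obtain ⟨i, -, hi⟩ := Finset.mem_biUnion.1 (Finset.mem_def.2 hxr)
    rw [← hSdisj i j x hi hx]
    exact hi
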